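/- arXiv:2503.08949 — 2 statements merged into one kernel-verified Lean document; each statement's English description precedes it below -/
import Mathlib

section
/- Let s ∈ (0,1), t > 0, L > 0, and let q be a probability density on ℝ that is Lipschitz with constant L. Define D(u) = ∫_ℝ q(r)·u(−r) dr. Then there exists a constant C = C(s) > 0 such that for every measurable u : ℝ → ℝ with ‖u‖ < ∞ and every x ≠ 0, |(Fu)(x) − t^{2−s}·D(u)/|x|^{2−s}| ≤ C·t^{4−s}·L·‖u‖/|x|^{3−s}. -/
open MeasureTheory Real

/-- The transfer operator `F` with parameters `s`, `t` and kernel density `q`: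
`(Fu)(x) = (t^{2−s}/|x|^{2−s}) ∫ q(−y − t²/x) u(y) dy` for `x ≠ 0`, and `(Fu)(0) = 0`. -/
noncomputable def Fop (s t : ℝ) (q u : ℝ → ℝ) : ℝ → ℝ := fun x =>
  if x = 0 then 0
  else (t ^ (2 - s) / |x| ^ (2 - s)) * ∫ y : ℝ, q (-y - t ^ 2 / x) * u y

/-- The weight function `w(x) = 1 + |x|^{2−s}`. -/
noncomputable def wfun (s x : ℝ) : ℝ := 1 + |x| ^ (2 - s)

/-- The weighted supremum norm `‖f‖ = sup_x |f(x)|·w(x)`. -/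
noncomputable def xnorm (s : ℝ) (f : ℝ → ℝ) : ℝ := ⨆ x : ℝ, |f x| * wfun s x

/-- `f : ℝ → ℝ` is a probability density. -/
def IsProbDensity (f : ℝ → ℝ) : Prop :=
  Measurable f ∧ (∀ x, 0 ≤ f x) ∧ (∫ x, f x) = 1

theorem wfun_pos (s x : ℝ) : 0 < wfun s x := by
  unfold wfun; positivity

theorem one_le_wfun (s x : ℝ) : 1 ≤ wfun s x := by
  have : 0 ≤ |x| ^ (2 - s) := by positivity
  unfold wfun; linarith

theorem one_add_abs_rpow_le_wfun {s : ℝ} (hs : s ≤ 1) (x : ℝ) :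
    (1 + |x|) ^ (2 - s) ≤ 2 ^ (1 - s) * wfun s x := by
  have h := NNReal.rpow_add_le_mul_rpow_add_rpow 1 ‖x‖₊ (show 1 ≤ 2 - s by linarith)
  rw [NNReal.one_rpow, show 2 - s - 1 = 1 - s by ring] at h
  exact_mod_cast h

theorem measurable_wfun (s : ℝ) : Measurable (wfun s) := by
  unfold wfun; fun_prop

theorem integrable_inv_wfun {s : ℝ} (hs : s < 1) : Integrable fun x => (wfun s x)⁻¹ := by
  have h : Integrable fun x : ℝ => 2 ^ (1 - s) * (1 + ‖x‖) ^ (-(2 - s)) :=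
    (integrable_one_add_norm (by simp; linarith)).const_mul _
  refine h.mono' (measurable_wfun s).inv.aestronglyMeasurable (.of_forall fun x => ?_)
  have hx : 0 < 1 + |x| := by positivity
  rw [Real.norm_of_nonneg (inv_nonneg.2 (wfun_pos s x).le), Real.norm_eq_abs,
    Real.rpow_neg hx.le, ← div_eq_mul_inv, inv_eq_one_div,
    div_le_div_iff₀ (wfun_pos s x) (by positivity), one_mul]
  exact one_add_abs_rpow_le_wfun hs.le x

theorem abs_le_xnorm_mul_inv_wfun {s : ℝ} {u : ℝ → ℝ}
    (hu : BddAbove (Set.range fun x => |u x| * wfun s x)) (x : ℝ) :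
    |u x| ≤ xnorm s u * (wfun s x)⁻¹ := by
  rw [← div_eq_mul_inv, le_div_iff₀ (wfun_pos s x)]
  exact le_ciSup hu x

theorem xnorm_nonneg (s : ℝ) (u : ℝ → ℝ) : 0 ≤ xnorm s u :=
  Real.iSup_nonneg fun x => mul_nonneg (abs_nonneg _) (wfun_pos s x).le

theorem abs_le_xnorm {s : ℝ} {u : ℝ → ℝ}
    (hu : BddAbove (Set.range fun x => |u x| * wfun s x)) (x : ℝ) : |u x| ≤ xnorm s u :=
  (le_mul_of_one_le_right (abs_nonneg _) (one_le_wfun s x)).trans (le_ciSup hu x)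

theorem IsProbDensity.integrable {q : ℝ → ℝ} (hq : IsProbDensity q) : Integrable q :=
  .of_integral_ne_zero (by rw [hq.2.2]; exact one_ne_zero)

/-- Translating a Lipschitz kernel by `a` changes its integral against `u` by at most
`L * |a| * ‖u‖ * ∫ 1 / w`. -/
theorem abs_integral_translate_sub_le {s : ℝ} (hs : s < 1) {q u : ℝ → ℝ} {L : ℝ}
    (hq : Integrable q) (hL : ∀ x y : ℝ, |q x - q y| ≤ L * |x - y|) (hu : Measurable u)
    (hb : BddAbove (Set.range fun x => |u x| * wfun s x)) (a : ℝ) :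
    |(∫ y, q (-y - a) * u y) - ∫ r, q r * u (-r)|
      ≤ L * |a| * (xnorm s u * ∫ y, (wfun s y)⁻¹) := by
  have hbound : ∀ᵐ y, ‖u y‖ ≤ xnorm s u := .of_forall (abs_le_xnorm hb)
  have hint (b : ℝ) : Integrable fun y => q (-y - b) * u y :=
    (hq.comp_sub_right b).comp_neg.mul_bdd hu.aestronglyMeasurable hbound
  have hint₀ : Integrable fun y => q (-y) * u y := by simpa using hint 0
  have hflip : ∫ r, q r * u (-r) = ∫ y, q (-y) * u y := by
    simpa using (integral_neg_eq_self (fun y => q (-y) * u y) volume)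
  rw [hflip, ← integral_sub (hint a) hint₀, ← integral_const_mul, ← integral_const_mul,
    ← Real.norm_eq_abs]
  refine norm_integral_le_of_norm_le
    (((integrable_inv_wfun hs).const_mul _).const_mul _) (.of_forall fun y => ?_)
  rw [← sub_mul, norm_mul]
  have h := hL (-y - a) (-y)
  rw [show -y - a - -y = -a by ring, abs_neg] at h
  exact mul_le_mul h (abs_le_xnorm_mul_inv_wfun hb y) (abs_nonneg _) ((abs_nonneg _).trans h)

/-- Let `s ∈ (0,1)`, `t > 0`, `L > 0`, and let `q` be a probability
density that is Lipschitz with constant `L`.  With `D(u) = ∫ q(r)·u(−r) dr`, there exists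
`C = C(s) > 0` such that for every measurable `u` with `‖u‖ < ∞` and every `x ≠ 0`,
`|(Fu)(x) − t^{2−s}·D(u)/|x|^{2−s}| ≤ C·t^{4−s}·L·‖u‖/|x|^{3−s}`. -/
theorem stmt8 (s : ℝ) (hs : s ∈ Set.Ioo (0 : ℝ) 1) :
    ∃ C : ℝ, 0 < C ∧
      ∀ t L : ℝ, 0 < t → 0 < L →
      ∀ q : ℝ → ℝ, IsProbDensity q → (∀ x y : ℝ, |q x - q y| ≤ L * |x - y|) →
      ∀ u : ℝ → ℝ, Measurable u →
        BddAbove (Set.range fun x => |u x| * wfun s x) →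
        ∀ x : ℝ, x ≠ 0 →
          |Fop s t q u x - t ^ (2 - s) * (∫ r : ℝ, q r * u (-r)) / |x| ^ (2 - s)|
            ≤ C * t ^ (4 - s) * L * xnorm s u / |x| ^ (3 - s) := by
  refine ⟨(∫ y, (wfun s y)⁻¹) + 1, ?_, ?_⟩
  · have : 0 ≤ ∫ y, (wfun s y)⁻¹ := integral_nonneg fun y => inv_nonneg.2 (wfun_pos s y).le
    linarith
  intro t L ht hL q hq hLip u hu hb x hx
  have hx' : 0 < |x| := abs_pos.2 hx
  have key := abs_integral_translate_sub_le hs.2 hq.integrable hLip hu hb (t ^ 2 / x)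
  have hN := xnorm_nonneg s u
  set I := ∫ y, (wfun s y)⁻¹
  set N := xnorm s u
  have ht4 : t ^ (4 - s) = t ^ (2 - s) * t ^ 2 := by
    rw [← Real.rpow_add_natCast ht.ne']; congr 1; push_cast; ring
  have hx3 : |x| ^ (3 - s) = |x| ^ (2 - s) * |x| := by
    rw [← Real.rpow_add_one hx'.ne']; congr 1; ring
  rw [abs_div, abs_of_nonneg (sq_nonneg t)] at key
  rw [Fop, if_neg hx, mul_div_right_comm, ← mul_sub, abs_mul, abs_of_nonneg (by positivity),
    ht4, hx3]
  calc _ ≤ t ^ (2 - s) / |x| ^ (2 - s) * (L * (t ^ 2 / |x|) * (N * I)) := by gcongr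
    _ ≤ t ^ (2 - s) / |x| ^ (2 - s) * (L * (t ^ 2 / |x|) * (N * (I + 1))) := by
      gcongr; linarith
    _ = _ := by field_simp
end

section
/- Let s ∈ (0,1), t > 0, E ∈ ℝ, and L, C₀, c₀ > 0, and let q be a probability density on ℝ that is Lipschitz with constant L and satisfies c₀/(1 + (x + E)²) ≤ q(x) ≤ C₀/(1 + (x + E)²) for all x ∈ ℝ. Then there exist λ > 0 and a function v : ℝ → ℝ with v(x) > 0 for every x ∈ ℝ and ‖v‖ < ∞ such that (Fv)(x) = λ·v(x) for every x ≠ 0. Moreover, λ is the unique eigenvalue of F possessing a nonnegative eigenfunction: if μ ∈ ℝ and u : ℝ → [0,∞) is measurable with ‖u‖ < ∞, u not Lebesgue-almost-everywhere zero, and (Fu)(x) = μ·u(x) for every x ≠ 0, then μ = λ. -/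
open MeasureTheory Real

section Ordered

variable {X : Type*} [AddCommGroup X] [PartialOrder X] [IsOrderedAddMonoid X] [Module ℝ X]

theorem LinearMap.map_le_map_of_nonneg (T : X →ₗ[ℝ] X) (hT : ∀ u, 0 ≤ u → 0 ≤ T u) {u v : X}
    (h : u ≤ v) : T u ≤ T v := by
  have := hT (v - u) (sub_nonneg.2 h)
  rwa [map_sub, sub_nonneg] at this

/-- If a positive operator has eigenvectors `u ≤ C • v`, then the eigenvalue of `u` is at most
that of `v`. -/
theorem eigenvalue_le_of_le_smul (T : X →ₗ[ℝ] X) (hT : ∀ u, 0 ≤ u → 0 ≤ T u)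
    (l : X →ₗ[ℝ] ℝ) (hl : ∀ u, 0 ≤ u → 0 ≤ l u) {u v : X} {mu lam C : ℝ}
    (hlam : 0 < lam) (hu : T u = mu • u) (hv : T v = lam • v)
    (huv : u ≤ C • v) (hpos : 0 < l u) : mu ≤ lam := by
  have key : ∀ n : ℕ, mu ^ n • u ≤ (C * lam ^ n) • v := by
    intro n
    induction n with
    | zero => simpa using huv
    | succ n ih =>
      have := T.map_le_map_of_nonneg hT ih
      rw [map_smul, map_smul, hu, hv, smul_smul, smul_smul] at this
      simpa [pow_succ, mul_assoc] using this
  have key2 : ∀ n : ℕ, (mu / lam) ^ n ≤ C * l v / l u := by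
    intro n
    have := hl _ (sub_nonneg.2 (key n))
    simp only [map_sub, map_smul, smul_eq_mul, sub_nonneg] at this
    rw [div_pow, div_le_div_iff₀ (by positivity) hpos]
    linarith
  by_contra! h
  obtain ⟨n, hn⟩ := pow_unbounded_of_one_lt (C * l v / l u) ((one_lt_div hlam).2 h)
  exact absurd (key2 n) (not_le.2 hn)

variable [PosSMulMono ℝ X]

/-- **Birkhoff contraction.** A positive operator `T` whose cube satisfies a two-sided rank-one
bound contracts ratios. -/
theorem ratio_contraction (T : X →ₗ[ℝ] X) (l : X →ₗ[ℝ] ℝ) {φ : X} {m M : ℝ}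
    (hm : 0 < m) (hmM : m ≤ M)
    (hlow : ∀ u, 0 ≤ u → (m * l u) • φ ≤ T (T (T u)))
    (hupp : ∀ u, 0 ≤ u → T (T (T u)) ≤ (M * l u) • φ)
    {g f : X} {a : ℝ} (hg : 0 ≤ g) (hl : ∀ u, 0 ≤ u → 0 ≤ l u) (hlg : 0 < l g)
    (h : a • g ≤ f) :
    ((1 - m / M) * a + m / M * (l f / l g)) • T (T (T g)) ≤ T (T (T f)) := by
  have hM : 0 < M := hm.trans_le hmM
  have h1 := hlow _ (sub_nonneg.2 h)
  have h0 : 0 ≤ l f - a * l g := by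
    have := hl _ (sub_nonneg.2 h)
    simpa using this
  have h2 := hupp g hg
  have h3 := smul_le_smul_of_nonneg_left h2
    (show 0 ≤ m / M * ((l f - a * l g) / l g) by positivity)
  rw [smul_smul] at h3
  have e : m / M * ((l f - a * l g) / l g) * (M * l g) = m * l (f - a • g) := by
    simp only [map_sub, map_smul, smul_eq_mul]
    field_simp
  rw [e] at h3
  have h4 := h3.trans h1
  rw [map_sub, map_sub, map_sub, map_smul, map_smul, map_smul, le_sub_iff_add_le,
    ← add_smul] at h4
  convert h4 using 2
  field_simp
  ring

theorem exists_ratio_sequences (T : X →ₗ[ℝ] X) (hT : ∀ u, 0 ≤ u → 0 ≤ T u) (l : X →ₗ[ℝ] ℝ)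
    (hl : ∀ u, 0 ≤ u → 0 ≤ l u) {φ : X} {m M : ℝ} (hm : 0 < m) (hmM : m ≤ M)
    (hlow : ∀ u, 0 ≤ u → (m * l u) • φ ≤ T (T (T u)))
    (hupp : ∀ u, 0 ≤ u → T (T (T u)) ≤ (M * l u) • φ)
    {g₀ : X} {a₀ b₀ : ℝ} (hg₀ : 0 ≤ g₀) (ha₀ : 0 < a₀) (hab₀ : a₀ ≤ b₀) (hlg₀ : 0 < l g₀)
    (hlo₀ : a₀ • g₀ ≤ T g₀) (hup₀ : T g₀ ≤ b₀ • g₀) :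
    ∃ (g : ℕ → X) (a b : ℕ → ℝ), g 0 = g₀ ∧ a 0 = a₀ ∧ b 0 = b₀ ∧
      Monotone a ∧ Antitone b ∧ (∀ n, b n - a n = (1 - m / M) ^ n * (b₀ - a₀)) ∧
      (∀ n, a n • g n ≤ T (g n) ∧ T (g n) ≤ b n • g n) ∧
      (∀ n, 0 ≤ g n) ∧
      ∀ n, (a n ^ 3) • g n ≤ g (n + 1) ∧ g (n + 1) ≤ (b n ^ 3) • g n := by
  have hM : 0 < M := hm.trans_le hmM
  have hr : 0 < m / M := by positivity
  have hr1 : m / M ≤ 1 := (div_le_one hM).2 hmM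
  set r := m / M with hrdef
  obtain ⟨g, g0, gs⟩ : ∃ g : ℕ → X, g 0 = g₀ ∧ ∀ n, g (n + 1) = T (T (T (g n))) :=
    ⟨fun n => Nat.rec g₀ (fun _ x => T (T (T x))) n, rfl, fun _ => rfl⟩
  set ρ : ℕ → ℝ := fun n => l (T (g n)) / l (g n) with hρ
  obtain ⟨a, a0, as⟩ : ∃ a : ℕ → ℝ, a 0 = a₀ ∧ ∀ n, a (n + 1) = (1 - r) * a n + r * ρ n :=
    ⟨fun n => Nat.rec a₀ (fun n x => (1 - r) * x + r * ρ n) n, rfl, fun _ => rfl⟩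
  obtain ⟨b, b0, bs⟩ : ∃ b : ℕ → ℝ, b 0 = b₀ ∧ ∀ n, b (n + 1) = (1 - r) * b n + r * ρ n :=
    ⟨fun n => Nat.rec b₀ (fun n x => (1 - r) * x + r * ρ n) n, rfl, fun _ => rfl⟩
  have cube : ∀ {x : X} {α β : ℝ}, 0 ≤ α → 0 ≤ β → α • x ≤ T x → T x ≤ β • x →
      (α ^ 3) • x ≤ T (T (T x)) ∧ T (T (T x)) ≤ (β ^ 3) • x := by
    intro x α β hα hβ h1 h2
    have l1 := T.map_le_map_of_nonneg hT h1
    have l2 := T.map_le_map_of_nonneg hT l1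
    have u1 := T.map_le_map_of_nonneg hT h2
    have u2 := T.map_le_map_of_nonneg hT u1
    simp only [map_smul] at l1 l2 u1 u2
    have l3 := smul_le_smul_of_nonneg_left l1 hα
    have l4 := smul_le_smul_of_nonneg_left h1 (mul_nonneg hα hα)
    have u3 := smul_le_smul_of_nonneg_left u1 hβ
    have u4 := smul_le_smul_of_nonneg_left h2 (mul_nonneg hβ hβ)
    simp only [smul_smul] at l3 l4 u3 u4
    constructor
    · rw [show α ^ 3 = α * α * α by ring]; exact (l4.trans l3).trans l2
    · rw [show β ^ 3 = β * β * β by ring]; exact u2.trans (u3.trans u4)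
  have main : ∀ n, 0 < a n ∧ a n ≤ b n ∧ 0 ≤ g n ∧ 0 < l (g n) ∧ a n • g n ≤ T (g n) ∧
      T (g n) ≤ b n • g n := by
    intro n
    induction n with
    | zero => rw [a0, b0, g0]; exact ⟨ha₀, hab₀, hg₀, hlg₀, hlo₀, hup₀⟩
    | succ n ih =>
      obtain ⟨ha, hab, hg, hlg, h1, h2⟩ := ih
      have hb : 0 < b n := ha.trans_le hab
      have hρpos : 0 < ρ n := by
        have := hl _ (sub_nonneg.2 h1)
        simp only [map_sub, map_smul, smul_eq_mul, sub_nonneg] at this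
        exact div_pos (by nlinarith [mul_pos ha hlg]) hlg
      refine ⟨?_, ?_, ?_, ?_, ?_, ?_⟩
      · rw [as]
        have : 0 ≤ (1 - r) * a n := mul_nonneg (by linarith) ha.le
        have : 0 < r * ρ n := mul_pos hr hρpos
        linarith
      · rw [as, bs]
        have := mul_le_mul_of_nonneg_left hab (show 0 ≤ 1 - r by linarith)
        linarith
      · rw [gs]; exact hT _ (hT _ (hT _ hg))
      · rw [gs]
        have := hl _ (sub_nonneg.2 (cube ha.le hb.le h1 h2).1)
        simp only [map_sub, map_smul, smul_eq_mul, sub_nonneg] at this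
        exact lt_of_lt_of_le (by positivity) this
      · rw [as, gs]
        exact ratio_contraction T l hm hmM hlow hupp hg hl hlg h1
      · rw [bs, gs]
        have := ratio_contraction T l (f := - T (g n)) (a := - b n) hm hmM hlow hupp hg hl hlg
          (by rw [neg_smul]; exact neg_le_neg h2)
        simp only [map_neg] at this
        rw [le_neg, ← neg_smul] at this
        convert this using 2
        rw [hρ]; simp only; ring
  have hρa : ∀ n, a n ≤ ρ n := by
    intro n
    obtain ⟨ha, hab, hg, hlg, h1, h2⟩ := main n
    have := hl _ (sub_nonneg.2 h1)
    simp only [map_sub, map_smul, smul_eq_mul, sub_nonneg] at this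
    rw [hρ]; exact (le_div_iff₀ hlg).2 this
  have hρb : ∀ n, ρ n ≤ b n := by
    intro n
    obtain ⟨ha, hab, hg, hlg, h1, h2⟩ := main n
    have := hl _ (sub_nonneg.2 h2)
    simp only [map_sub, map_smul, smul_eq_mul, sub_nonneg] at this
    rw [hρ]; exact (div_le_iff₀ hlg).2 this
  refine ⟨g, a, b, g0, a0, b0, monotone_nat_of_le_succ fun n => ?_,
    antitone_nat_of_succ_le fun n => ?_, fun n => ?_,
    fun n => ⟨(main n).2.2.2.2.1, (main n).2.2.2.2.2⟩, fun n => (main n).2.2.1, fun n => ?_⟩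
  · rw [as]; nlinarith [hρa n]
  · rw [bs]; nlinarith [hρb n]
  · induction n with
    | zero => simp [a0, b0]
    | succ n ih => rw [as, bs, pow_succ]; linear_combination (1 - r) * ih
  · rw [gs]
    obtain ⟨ha, hab, hg, hlg, h1, h2⟩ := main n
    exact cube ha.le (ha.le.trans hab) h1 h2

/-- Normalised iterates of a positive operator whose cube satisfies a two-sided rank-one bound
form a decreasing sequence of approximate eigenvectors, bounded away from zero. -/
theorem exists_approx_eigenvectors (T : X →ₗ[ℝ] X) (hT : ∀ u, 0 ≤ u → 0 ≤ T u)
    (l : X →ₗ[ℝ] ℝ) (hl : ∀ u, 0 ≤ u → 0 ≤ l u) {φ : X} {m M : ℝ} (hm : 0 < m) (hmM : m ≤ M)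
    (hlow : ∀ u, 0 ≤ u → (m * l u) • φ ≤ T (T (T u)))
    (hupp : ∀ u, 0 ≤ u → T (T (T u)) ≤ (M * l u) • φ)
    (hφ : 0 ≤ φ) (hlφ : 0 < l φ) (hlTφ : 0 < l (T φ)) :
    ∃ (lam : ℝ) (c : ℝ) (h : ℕ → X) (a b : ℕ → ℝ), 0 < lam ∧ 0 < c ∧
      Filter.Tendsto a Filter.atTop (nhds lam) ∧ Filter.Tendsto b Filter.atTop (nhds lam) ∧
      (∀ n, a n • h n ≤ T (h n) ∧ T (h n) ≤ b n • h n) ∧ Antitone h ∧ ∀ n, c • φ ≤ h n := by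
  have hM : 0 < M := hm.trans_le hmM
  have hTφ := hT φ hφ
  have p1 := hlow φ hφ
  have p2 := hupp φ hφ
  have p3 := hlow _ hTφ
  have p4 := hupp _ hTφ
  have hc : 0 < m * l φ := by positivity
  have hg₀ : 0 ≤ T (T (T φ)) := hT _ (hT _ hTφ)
  have hlg₀ : 0 < l (T (T (T φ))) := by
    have := hl _ (sub_nonneg.2 p1)
    simp only [map_sub, map_smul, smul_eq_mul, sub_nonneg] at this
    exact lt_of_lt_of_le (by positivity) this
  set g₀ := T (T (T φ)) with hg₀def
  have q1 : (m * l (T φ) / (M * l φ)) • g₀ ≤ T g₀ := by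
    have := smul_le_smul_of_nonneg_left p2 (show 0 ≤ m * l (T φ) / (M * l φ) by positivity)
    rw [smul_smul, div_mul_cancel₀ _ (by positivity)] at this
    exact this.trans p3
  have q2 : T g₀ ≤ (M * l (T φ) / (m * l φ)) • g₀ := by
    have := smul_le_smul_of_nonneg_left p1 (show 0 ≤ M * l (T φ) / (m * l φ) by positivity)
    rw [smul_smul, div_mul_cancel₀ _ (by positivity)] at this
    exact p4.trans this
  set a₀ := m * l (T φ) / (M * l φ) with ha₀def
  set b₀ := M * l (T φ) / (m * l φ) with hb₀def
  have ha₀ : 0 < a₀ := by positivity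
  have hab₀ : a₀ ≤ b₀ := by rw [ha₀def, hb₀def]; gcongr
  obtain ⟨g, a, b, g0, a0, b0, hamono, hbanti, hgap, hbd, hgpos, hstep⟩ :=
    exists_ratio_sequences T hT l hl hm hmM hlow hupp hg₀ ha₀ hab₀ hlg₀ q1 q2
  have hr : 0 < m / M := by positivity
  have hr1 : m / M ≤ 1 := (div_le_one hM).2 hmM
  set θ := 1 - m / M with hθ
  have hθ0 : 0 ≤ θ := by linarith
  have hθ1 : θ < 1 := by linarith
  have hapos : ∀ n, a₀ ≤ a n := fun n => a0 ▸ hamono (Nat.zero_le n)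
  have hab : ∀ n, a n ≤ b n := fun n => by
    have := hgap n
    have : 0 ≤ θ ^ n * (b₀ - a₀) := mul_nonneg (pow_nonneg hθ0 n) (by linarith)
    linarith
  have hbpos : ∀ n, 0 < b n := fun n => ha₀.trans_le ((hapos n).trans (hab n))
  have hbb : BddBelow (Set.range b) := ⟨0, by rintro _ ⟨n, rfl⟩; exact (hbpos n).le⟩
  have hblim := tendsto_atTop_ciInf hbanti hbb
  set lam := ⨅ n, b n with hlam
  have hgaplim : Filter.Tendsto (fun n => θ ^ n * (b₀ - a₀)) Filter.atTop (nhds 0) := by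
    simpa using (tendsto_pow_atTop_nhds_zero_of_lt_one hθ0 hθ1).mul_const (b₀ - a₀)
  have halim : Filter.Tendsto a Filter.atTop (nhds lam) := by
    have : a = fun n => b n - θ ^ n * (b₀ - a₀) := by
      ext n; linarith [hgap n]
    rw [this]; simpa using hblim.sub hgaplim
  have hlampos : 0 < lam := ha₀.trans_le (ge_of_tendsto' halim hapos)
  set P : ℕ → ℝ := fun n => ∏ k ∈ Finset.range n, b k with hP
  set Q : ℕ → ℝ := fun n => ∏ k ∈ Finset.range n, a k with hQ
  have hPpos : ∀ n, 0 < P n := fun n => Finset.prod_pos fun k _ => hbpos k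
  have hQpos : ∀ n, 0 < Q n := fun n => Finset.prod_pos fun k _ => ha₀.trans_le (hapos k)
  have hQg : ∀ n, (Q n ^ 3) • g₀ ≤ g n := by
    intro n
    induction n with
    | zero => simp [hQ, g0]
    | succ n ih =>
      have := smul_le_smul_of_nonneg_left ih (pow_nonneg (ha₀.le.trans (hapos n)) 3)
      rw [smul_smul] at this
      have e : Q (n + 1) ^ 3 = a n ^ 3 * Q n ^ 3 := by
        simp only [hQ, Finset.prod_range_succ]; ring
      rw [e]
      exact this.trans (hstep n).1
  set D := (b₀ - a₀) / a₀ / (1 - θ) with hD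
  have hPQ : ∀ n, P n ≤ Real.exp D * Q n := by
    intro n
    have h1 : ∀ n, P n ≤ Real.exp (∑ k ∈ Finset.range n, (b₀ - a₀) / a₀ * θ ^ k) * Q n := by
      intro n
      induction n with
      | zero => simp [hP, hQ]
      | succ n ih =>
        have e1 : P (n + 1) = P n * b n := Finset.prod_range_succ _ _
        have e2 : Q (n + 1) = Q n * a n := Finset.prod_range_succ _ _
        rw [e1, e2, Finset.sum_range_succ, Real.exp_add]
        have hb : b n ≤ Real.exp ((b₀ - a₀) / a₀ * θ ^ n) * a n := by
          have h2 := Real.add_one_le_exp ((b₀ - a₀) / a₀ * θ ^ n)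
          have h3 : b n ≤ ((b₀ - a₀) / a₀ * θ ^ n + 1) * a n := by
            have h4 := hgap n
            have h5 : θ ^ n * (b₀ - a₀) ≤ (b₀ - a₀) / a₀ * θ ^ n * a n := by
              rw [show (b₀ - a₀) / a₀ * θ ^ n * a n = θ ^ n * (b₀ - a₀) * (a n / a₀) by ring]
              exact le_mul_of_one_le_right (mul_nonneg (pow_nonneg hθ0 n) (by linarith))
                ((one_le_div ha₀).2 (hapos n))
            linarith
          exact h3.trans (mul_le_mul_of_nonneg_right h2 (ha₀.le.trans (hapos n)))
        calc P n * b n ≤ _ * _ := mul_le_mul ih hb (hbpos n).le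
              (mul_nonneg (Real.exp_pos _).le (hQpos n).le)
          _ = _ := by ring
    refine (h1 n).trans (mul_le_mul_of_nonneg_right (Real.exp_le_exp.2 ?_) (hQpos n).le)
    rw [← Finset.mul_sum, hD, div_eq_mul_inv _ (1 - θ)]
    refine mul_le_mul_of_nonneg_left ?_ (div_nonneg (by linarith) ha₀.le)
    rw [← tsum_geometric_of_lt_one hθ0 hθ1]
    exact (summable_geometric_of_lt_one hθ0 hθ1).sum_le_tsum _ (fun k _ => pow_nonneg hθ0 k)
  refine ⟨lam, (Real.exp D ^ 3)⁻¹ * (m * l φ), fun n => (P n ^ 3)⁻¹ • g n, a, b, hlampos,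
    by positivity, halim, hblim, fun n => ?_, antitone_nat_of_succ_le fun n => ?_, fun n => ?_⟩
  · have hp : 0 ≤ (P n ^ 3)⁻¹ := by have := hPpos n; positivity
    have h1 := smul_le_smul_of_nonneg_left (hbd n).1 hp
    have h2 := smul_le_smul_of_nonneg_left (hbd n).2 hp
    rw [map_smul, smul_comm (a n), smul_comm (b n)]
    exact ⟨h1, h2⟩
  · have hp : 0 ≤ (P (n + 1) ^ 3)⁻¹ := by have := hPpos (n + 1); positivity
    have h2 := smul_le_smul_of_nonneg_left (hstep n).2 hp
    refine h2.trans_eq ?_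
    rw [smul_smul]
    congr 1
    have e1 : P (n + 1) = P n * b n := Finset.prod_range_succ _ _
    have := hPpos n
    have := hbpos n
    rw [e1]; field_simp
  · have hp : 0 ≤ (P n ^ 3)⁻¹ := by have := hPpos n; positivity
    have h1 := smul_le_smul_of_nonneg_left (hQg n) hp
    rw [smul_smul] at h1
    refine le_trans ?_ h1
    have h2 : (Real.exp D ^ 3)⁻¹ ≤ (P n ^ 3)⁻¹ * Q n ^ 3 := by
      have := hPpos n
      rw [inv_mul_eq_div, inv_eq_one_div, div_le_div_iff₀ (by positivity) (by positivity), one_mul,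
        ← mul_pow, mul_comm]
      exact pow_le_pow_left₀ (hPpos n).le (hPQ n) 3
    have h3 := smul_le_smul_of_nonneg_left p1 (show 0 ≤ (Real.exp D ^ 3)⁻¹ by positivity)
    rw [smul_smul] at h3
    refine h3.trans ?_
    have h4 := smul_nonneg (sub_nonneg.2 h2) hg₀
    rwa [sub_smul, sub_nonneg] at h4

end Ordered

/-- The polynomially decaying profile `(1 + |x|)^{-(2-s)}`. -/
noncomputable def decay (s x : ℝ) : ℝ := (1 + |x|) ^ (-(2 - s))

/-- Integration against the weight `(1 + |y|)^{-2}`. -/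
noncomputable def weightedIntegral (u : ℝ → ℝ) : ℝ := ∫ y : ℝ, u y / (1 + |y|) ^ 2

/-- Measurable functions dominated by a multiple of `decay s`. -/
def decaySpace (s : ℝ) : Submodule ℝ (ℝ → ℝ) where
  carrier := {u | Measurable u ∧ ∃ B, ∀ x, |u x| ≤ B * decay s x}
  zero_mem' := ⟨measurable_const, 0, by simp⟩
  add_mem' := by
    rintro u v ⟨hu, B, hB⟩ ⟨hv, B', hB'⟩
    refine ⟨hu.add hv, B + B', fun x => ?_⟩
    rw [add_mul]
    exact (abs_add_le _ _).trans (add_le_add (hB x) (hB' x))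
  smul_mem' := by
    rintro r u ⟨hu, B, hB⟩
    refine ⟨hu.const_smul r, |r| * B, fun x => ?_⟩
    rw [Pi.smul_apply, smul_eq_mul, abs_mul, mul_assoc]
    exact mul_le_mul_of_nonneg_left (hB x) (abs_nonneg r)

instance decaySpace.instPosSMulMono (s : ℝ) : PosSMulMono ℝ (decaySpace s) where
  smul_le_smul_of_nonneg_left := by
    intro r hr u v huv x
    exact mul_le_mul_of_nonneg_left (huv x) hr

/-- `q` is measurable and comparable to `(1 + |x|)^{-2}`. -/
structure IsCauchyLike (c C : ℝ) (q : ℝ → ℝ) : Prop where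
  measurable : Measurable q
  c_pos : 0 < c
  C_pos : 0 < C
  lower : ∀ x, c / (1 + |x|) ^ 2 ≤ q x
  upper : ∀ x, q x ≤ C / (1 + |x|) ^ 2

theorem one_add_abs_add_le (x y : ℝ) : 1 + |x + y| ≤ (1 + |x|) * (1 + |y|) := by
  nlinarith [abs_add_le x y, abs_nonneg x, abs_nonneg y, mul_nonneg (abs_nonneg x) (abs_nonneg y)]

theorem isCauchyLike_of_shifted {E C₀ c₀ : ℝ} {q : ℝ → ℝ} (hq : Measurable q)
    (hC₀ : 0 < C₀) (hc₀ : 0 < c₀)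
    (hlow : ∀ x, c₀ / (1 + (x + E) ^ 2) ≤ q x) (hupp : ∀ x, q x ≤ C₀ / (1 + (x + E) ^ 2)) :
    IsCauchyLike (c₀ / (1 + |E|) ^ 2) (2 * C₀ * (1 + |E|) ^ 2) q := by
  refine ⟨hq, by positivity, by positivity, fun x => le_trans ?_ (hlow x),
    fun x => (hupp x).trans ?_⟩
  · rw [div_div]
    refine div_le_div_of_nonneg_left hc₀.le (by positivity) ?_
    rw [← mul_pow]
    have h1 := one_add_abs_add_le x E
    have h2 := pow_le_pow_left₀ (by positivity) h1 2
    nlinarith [sq_abs (x + E), abs_nonneg (x + E)]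
  · rw [div_le_div_iff₀ (by positivity) (by positivity)]
    have h1 := one_add_abs_add_le (x + E) (-E)
    rw [add_neg_cancel_right, abs_neg] at h1
    have h2 := pow_le_pow_left₀ (by positivity) h1 2
    have h3 : (1 + |x|) ^ 2 ≤ 2 * (1 + (x + E) ^ 2) * (1 + |E|) ^ 2 := by
      refine h2.trans ?_
      rw [mul_pow]
      gcongr
      nlinarith [sq_abs (x + E), sq_nonneg (|x + E| - 1)]
    nlinarith

theorem decay_pos (s x : ℝ) : 0 < decay s x := by
  unfold decay; positivity

theorem measurable_decay (s : ℝ) : Measurable (decay s) := by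
  unfold decay; fun_prop

theorem decay_mem (s : ℝ) : decay s ∈ decaySpace s :=
  ⟨measurable_decay s, 1, fun x => by rw [one_mul, abs_of_pos (decay_pos s x)]⟩

theorem integrable_decay {s : ℝ} (hs : s < 1) : Integrable (decay s) := by
  have := integrable_one_add_norm (E := ℝ) (μ := volume) (r := 2 - s) (by simp; linarith)
  exact this

theorem integrable_inv_one_add_abs_sq : Integrable fun y : ℝ => 1 / (1 + |y|) ^ 2 := by
  have := integrable_decay (s := 0) one_pos
  refine this.congr (ae_of_all _ fun y => ?_)
  have : (0 : ℝ) ≤ 1 + |y| := by positivity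
  simp only [decay, sub_zero, one_div]
  rw [Real.rpow_neg this, Real.rpow_two]

section Kernel

variable {s t c C : ℝ} {q : ℝ → ℝ}

theorem IsCauchyLike.nonneg (hq : IsCauchyLike c C q) (x : ℝ) : 0 ≤ q x :=
  le_trans (by have := hq.c_pos; positivity) (hq.lower x)

theorem IsCauchyLike.le_const (hq : IsCauchyLike c C q) (x : ℝ) : q x ≤ C := by
  refine (hq.upper x).trans (div_le_self hq.C_pos.le ?_)
  nlinarith [abs_nonneg x]

theorem integrable_of_mem_decaySpace (hs : s < 1) {u : ℝ → ℝ} (hu : u ∈ decaySpace s) :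
    Integrable u := by
  obtain ⟨hm, B, hB⟩ := hu
  exact ((integrable_decay hs).const_mul B).mono' hm.aestronglyMeasurable (ae_of_all _ hB)

theorem integrable_weighted (hs : s < 1) {u : ℝ → ℝ} (hu : u ∈ decaySpace s) :
    Integrable fun y => u y / (1 + |y|) ^ 2 := by
  refine (integrable_of_mem_decaySpace hs hu).mono
    (hu.1.div (by fun_prop)).aestronglyMeasurable (ae_of_all _ fun y => ?_)
  rw [norm_div, norm_of_nonneg (show (0 : ℝ) ≤ (1 + |y|) ^ 2 by positivity)]
  exact div_le_self (norm_nonneg _) (by nlinarith [abs_nonneg y])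

theorem weightedIntegral_nonneg {u : ℝ → ℝ} (hu : 0 ≤ u) : 0 ≤ weightedIntegral u :=
  integral_nonneg fun y => div_nonneg (hu y) (by positivity)

theorem IsCauchyLike.integrable_mul (hq : IsCauchyLike c C q) (hs : s < 1) {u : ℝ → ℝ}
    (hu : u ∈ decaySpace s) (z : ℝ) : Integrable fun y => q (-y - z) * u y := by
  refine ((integrable_of_mem_decaySpace hs hu).norm.const_mul C).mono'
    ((hq.measurable.comp (by fun_prop)).mul hu.1).aestronglyMeasurable (ae_of_all _ fun y => ?_)
  rw [norm_mul, norm_of_nonneg (hq.nonneg _)]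
  exact mul_le_mul_of_nonneg_right (hq.le_const _) (norm_nonneg _)

theorem Fop_of_ne_zero (s t : ℝ) (q u : ℝ → ℝ) {x : ℝ} (hx : x ≠ 0) :
    Fop s t q u x = t ^ (2 - s) / |x| ^ (2 - s) * ∫ y : ℝ, q (-y - t ^ 2 / x) * u y :=
  if_neg hx

theorem Fop_zero (s t : ℝ) (q u : ℝ → ℝ) : Fop s t q u 0 = 0 := if_pos rfl

theorem IsCauchyLike.convolution_le (hq : IsCauchyLike c C q) (hs0 : 0 < s) (hs : s < 1) :
    ∃ D, 0 < D ∧ ∀ z, ∫ y, q (-y - z) * decay s y ≤ D * decay s z := by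
  set A := ∫ y, decay s y with hA
  set A' := ∫ y : ℝ, 1 / (1 + |y|) ^ 2 with hA'
  have hA0 : 0 ≤ A := integral_nonneg fun y => (decay_pos s y).le
  have hA'0 : 0 ≤ A' := integral_nonneg fun y => by positivity
  have hC := hq.C_pos
  refine ⟨C * 2 ^ (2 - s) * (A + A' + 1), by positivity, fun z => ?_⟩
  have hint : Integrable fun y : ℝ => 1 / (1 + |y + z|) ^ 2 :=
    integrable_inv_one_add_abs_sq.comp_add_right z
  have hI : ∫ y : ℝ, 1 / (1 + |y + z|) ^ 2 = A' :=
    integral_add_right_eq_self (fun y : ℝ => 1 / (1 + |y|) ^ 2) z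
  have hptw : ∀ y, q (-y - z) * decay s y ≤
      C * 2 ^ (2 - s) * decay s z * (decay s y + 1 / (1 + |y + z|) ^ 2) := by
    intro y
    have h1 := hq.upper (-y - z)
    rw [show -y - z = -(y + z) by ring, abs_neg] at h1
    rw [show -y - z = -(y + z) by ring]
    have hz : 0 < 1 + |z| := by positivity
    have hy : 0 < 1 + |y| := by positivity
    have hyz : 0 < 1 + |y + z| := by positivity
    have hdz := decay_pos s z
    have hdy := decay_pos s y
    have h2 : 1 ≤ 2 ^ (2 - s) * decay s z *
        ((1 + |y + z|) ^ (2 - s) + (1 + |y|) ^ (2 - s)) := by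
      have h3 : (1 + |z|) ^ (2 - s) ≤
          2 ^ (2 - s) * ((1 + |y + z|) ^ (2 - s) + (1 + |y|) ^ (2 - s)) := by
        have h4 : 1 + |z| ≤ 2 * max (1 + |y + z|) (1 + |y|) := by
          have : |z| ≤ |y + z| + |y| := by
            have := abs_sub (y + z) y
            rwa [add_sub_cancel_left] at this
          linarith [le_max_left (1 + |y + z|) (1 + |y|), le_max_right (1 + |y + z|) (1 + |y|)]
        have h5 := Real.rpow_le_rpow hz.le h4 (show 0 ≤ 2 - s by linarith)
        rw [Real.mul_rpow zero_le_two (by positivity)] at h5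
        refine h5.trans (mul_le_mul_of_nonneg_left ?_ (by positivity))
        rcases max_choice (1 + |y + z|) (1 + |y|) with h | h <;> rw [h]
        · linarith [Real.rpow_nonneg hy.le (2 - s)]
        · linarith [Real.rpow_nonneg hyz.le (2 - s)]
      have h6 := mul_le_mul_of_nonneg_left h3 hdz.le
      have h7 : decay s z * (1 + |z|) ^ (2 - s) = 1 := by
        rw [decay, ← Real.rpow_add hz]; simp
      rw [h7] at h6
      linarith
    have h8 : (1 + |y + z|) ^ (2 - s) / (1 + |y + z|) ^ 2 ≤ 1 := by
      rw [div_le_one (by positivity), ← Real.rpow_two]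
      exact Real.rpow_le_rpow_of_exponent_le (by linarith [abs_nonneg (y + z)]) (by linarith)
    have h9 : decay s y * (1 + |y|) ^ (2 - s) = 1 := by
      rw [decay, ← Real.rpow_add hy]; simp
    calc q (-(y + z)) * decay s y
        ≤ C / (1 + |y + z|) ^ 2 * decay s y := mul_le_mul_of_nonneg_right h1 hdy.le
      _ ≤ C / (1 + |y + z|) ^ 2 * decay s y * (2 ^ (2 - s) * decay s z *
          ((1 + |y + z|) ^ (2 - s) + (1 + |y|) ^ (2 - s))) :=
          le_mul_of_one_le_right (by positivity) h2
      _ = C * 2 ^ (2 - s) * decay s z *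
          (decay s y * ((1 + |y + z|) ^ (2 - s) / (1 + |y + z|) ^ 2) +
            decay s y * (1 + |y|) ^ (2 - s) * (1 / (1 + |y + z|) ^ 2)) := by ring
      _ ≤ _ := by
          rw [h9, one_mul]
          refine mul_le_mul_of_nonneg_left ?_ (by positivity)
          have := mul_le_mul_of_nonneg_left h8 hdy.le
          linarith
  have hmem := decay_mem s
  refine (integral_mono (hq.integrable_mul hs hmem z)
    (((integrable_decay hs).add hint).const_mul _) hptw).trans ?_
  simp only [Pi.add_apply]
  rw [integral_const_mul, integral_add (integrable_decay hs) hint, hI]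
  have : 0 ≤ C * 2 ^ (2 - s) * decay s z := by
    have := decay_pos s z
    positivity
  linarith

/-- The prefactor of the transfer operator compensates the decay in `t² / x`. -/
theorem prefactor_mul_decay_le (hs : s < 1) (ht : 0 < t) :
    ∃ D, 0 < D ∧ ∀ x, x ≠ 0 →
      t ^ (2 - s) / |x| ^ (2 - s) * decay s (t ^ 2 / x) ≤ D * decay s x := by
  have hm : 0 < min 1 (t ^ 2) := lt_min one_pos (by positivity)
  refine ⟨t ^ (2 - s) * (min 1 (t ^ 2)) ^ (-(2 - s)), by positivity, fun x hx => ?_⟩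
  have hx' : 0 < |x| := abs_pos.2 hx
  have e : t ^ (2 - s) / |x| ^ (2 - s) * decay s (t ^ 2 / x) =
      t ^ (2 - s) * (|x| + t ^ 2) ^ (-(2 - s)) := by
    rw [decay, div_eq_mul_inv, ← Real.rpow_neg hx'.le, mul_assoc,
      ← Real.mul_rpow hx'.le (by positivity), abs_div, abs_of_pos (show 0 < t ^ 2 by positivity)]
    congr 2
    field_simp
  rw [e, decay, mul_assoc, ← Real.mul_rpow hm.le (by positivity)]
  refine mul_le_mul_of_nonneg_left ?_ (by positivity)
  refine Real.rpow_le_rpow_of_nonpos (by positivity) ?_ (by linarith)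
  nlinarith [min_le_left 1 (t ^ 2), min_le_right 1 (t ^ 2), abs_nonneg x]

theorem prefactor_nonneg (ht : 0 < t) (x : ℝ) : 0 ≤ t ^ (2 - s) / |x| ^ (2 - s) := by positivity

theorem Fop_nonneg (hq : IsCauchyLike c C q) (ht : 0 < t) {u : ℝ → ℝ} (hu : 0 ≤ u) :
    0 ≤ Fop s t q u := by
  intro x
  by_cases hx : x = 0
  · rw [hx, Fop_zero]; rfl
  · rw [Fop_of_ne_zero _ _ _ _ hx]
    exact mul_nonneg (prefactor_nonneg ht x)
      (integral_nonneg fun y => mul_nonneg (hq.nonneg _) (hu y))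

theorem abs_Fop_le (hq : IsCauchyLike c C q) (hs0 : 0 < s) (hs : s < 1) (ht : 0 < t) :
    ∃ D, 0 < D ∧ ∀ (B : ℝ) (u : ℝ → ℝ), 0 ≤ B → u ∈ decaySpace s →
      (∀ x, |u x| ≤ B * decay s x) → ∀ x, |Fop s t q u x| ≤ D * B * decay s x := by
  obtain ⟨D, hD, h1⟩ := hq.convolution_le hs0 hs
  obtain ⟨D', hD', h2⟩ := prefactor_mul_decay_le hs ht
  refine ⟨D * D', by positivity, fun B u hB hu hle x => ?_⟩
  have hd := decay_pos s x
  by_cases hx : x = 0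
  · rw [hx, Fop_zero, abs_zero]
    have := decay_pos s 0
    positivity
  rw [Fop_of_ne_zero _ _ _ _ hx, abs_mul, abs_of_nonneg (prefactor_nonneg ht x)]
  have hmem := decay_mem s
  have h3 : |∫ y, q (-y - t ^ 2 / x) * u y| ≤ B * (D * decay s (t ^ 2 / x)) := by
    refine (abs_integral_le_integral_abs).trans ?_
    refine le_trans ?_ (mul_le_mul_of_nonneg_left (h1 _) hB)
    rw [← integral_const_mul]
    refine integral_mono (hq.integrable_mul hs hu _).abs
      ((hq.integrable_mul hs hmem _).const_mul B) fun y => ?_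
    simp only [abs_mul, abs_of_nonneg (hq.nonneg _)]
    have := mul_le_mul_of_nonneg_left (hle y) (hq.nonneg (-y - t ^ 2 / x))
    linarith
  refine (mul_le_mul_of_nonneg_left h3 (prefactor_nonneg ht x)).trans ?_
  have h4 := mul_le_mul_of_nonneg_left (h2 x hx) (mul_nonneg hB hD.le)
  linarith

theorem measurable_Fop (hq : IsCauchyLike c C q) {u : ℝ → ℝ} (hu : Measurable u) :
    Measurable (Fop s t q u) := by
  have h : Measurable fun x : ℝ => ∫ y : ℝ, q (-y - t ^ 2 / x) * u y := by
    have h1 : Measurable fun p : ℝ × ℝ => q (-p.2 - t ^ 2 / p.1) * u p.2 :=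
      (hq.measurable.comp (by fun_prop)).mul (hu.comp measurable_snd)
    exact h1.stronglyMeasurable.integral_prod_right.measurable
  exact Measurable.ite (measurableSet_singleton 0) measurable_const
    (Measurable.mul (by fun_prop) h)

theorem Fop_mem (hq : IsCauchyLike c C q) (hs0 : 0 < s) (hs : s < 1) (ht : 0 < t)
    {u : ℝ → ℝ} (hu : u ∈ decaySpace s) : Fop s t q u ∈ decaySpace s := by
  obtain ⟨D, -, h⟩ := abs_Fop_le hq hs0 hs ht
  obtain ⟨B, hB⟩ := hu.2
  have hB0 : 0 ≤ B := by
    by_contra! hB0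
    have := (abs_nonneg _).trans (hB 0)
    nlinarith [decay_pos s 0]
  exact ⟨measurable_Fop hq hu.1, D * B, h B u hB0 hu hB⟩

theorem Fop_le_weightedIntegral_add (hq : IsCauchyLike c C q) (hs0 : 0 < s) (hs : s < 1) (ht : 0 < t) :
    ∃ D, 0 < D ∧ ∀ (κ : ℝ) (g : ℝ → ℝ), 0 ≤ κ → 0 ≤ g → g ∈ decaySpace s →
      (∀ y, 1 ≤ |y| → g y ≤ κ * decay s y) →
      ∀ x, x ≠ 0 → Fop s t q g x ≤ D * (weightedIntegral g + κ) * decay s x := by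
  obtain ⟨D, hD, h1⟩ := hq.convolution_le hs0 hs
  obtain ⟨D', hD', h2⟩ := prefactor_mul_decay_le hs ht
  have hC := hq.C_pos
  refine ⟨(16 * C + D) * D', by positivity, fun κ g hκ hg hgm hle x hx => ?_⟩
  rw [Fop_of_ne_zero _ _ _ _ hx]
  set z := t ^ 2 / x
  have hd := decay_pos s x
  have hdz := decay_pos s z
  have hW := weightedIntegral_nonneg hg
  have hmem := decay_mem s
  have hptw : ∀ y, q (-y - z) * g y ≤
      16 * C * decay s z * (g y / (1 + |y|) ^ 2) + κ * (q (-y - z) * decay s y) := by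
    intro y
    have hgy := hg y
    have hdy := decay_pos s y
    have hqy := hq.nonneg (-y - z)
    rcases le_or_gt 1 |y| with hy | hy
    · have h3 := mul_le_mul_of_nonneg_left (hle y hy) hqy
      have : 0 ≤ 16 * C * decay s z * (g y / (1 + |y|) ^ 2) :=
        mul_nonneg (by positivity) (div_nonneg hgy (by positivity))
      linarith
    · have h4 : q (-y - z) ≤ 4 * C * decay s z := by
        refine (hq.upper _).trans ?_
        rw [show -y - z = -(y + z) by ring, abs_neg]
        have h5 := one_add_abs_add_le (y + z) (-y)
        rw [show y + z + -y = z by ring, abs_neg] at h5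
        have h6 : 1 + |z| ≤ 2 * (1 + |y + z|) := by
          nlinarith [abs_nonneg (y + z)]
        have h7 : 1 / (1 + |z|) ^ 2 ≤ decay s z := by
          rw [decay, Real.rpow_neg (by positivity), one_div, ← Real.rpow_two]
          refine inv_anti₀ (by positivity) ?_
          exact Real.rpow_le_rpow_of_exponent_le (by linarith [abs_nonneg z]) (by linarith)
        have h8 : C / (1 + |y + z|) ^ 2 ≤ 4 * C * (1 / (1 + |z|) ^ 2) := by
          rw [mul_one_div, div_le_div_iff₀ (by positivity) (by positivity)]
          have := pow_le_pow_left₀ (by positivity) h6 2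
          nlinarith
        exact h8.trans (mul_le_mul_of_nonneg_left h7 (by positivity))
      have h9 : g y ≤ 4 * (g y / (1 + |y|) ^ 2) := by
        rw [← mul_div_assoc, le_div_iff₀ (by positivity)]
        nlinarith [abs_nonneg y, show (1 + |y|) ^ 2 ≤ 4 by nlinarith [abs_nonneg y],
          show 0 ≤ g y from hgy]
      have h10 := mul_le_mul h4 h9 hgy (by positivity)
      have : 0 ≤ κ * (q (-y - z) * decay s y) := by positivity
      linarith
  have h11 : ∫ y, q (-y - z) * g y ≤
      16 * C * decay s z * weightedIntegral g + κ * (D * decay s z) := by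
    refine (integral_mono (hq.integrable_mul hs hgm z)
      (((integrable_weighted hs hgm).const_mul _).add
        ((hq.integrable_mul hs hmem z).const_mul κ)) hptw).trans ?_
    simp only [Pi.add_apply]
    rw [integral_add ((integrable_weighted hs hgm).const_mul _)
      ((hq.integrable_mul hs hmem z).const_mul κ), integral_const_mul, integral_const_mul]
    have := mul_le_mul_of_nonneg_left (h1 z) hκ
    unfold weightedIntegral
    linarith
  refine (mul_le_mul_of_nonneg_left h11 (prefactor_nonneg ht x)).trans ?_
  have h12 := mul_le_mul_of_nonneg_left (h2 x hx)
    (show 0 ≤ 16 * C * weightedIntegral g + κ * D by positivity)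
  have h13 : (16 * C * weightedIntegral g + κ * D) * (D' * decay s x) ≤
      (16 * C + D) * D' * (weightedIntegral g + κ) * decay s x := by
    have : 0 ≤ 16 * C * κ + D * weightedIntegral g := by positivity
    have := mul_nonneg this (mul_pos hD' hd).le
    linarith
  linarith

theorem Fop_le_of_one_le_abs (hq : IsCauchyLike c C q) (hs : s < 1) (ht : 0 < t) :
    ∃ D, 0 < D ∧ ∀ u : ℝ → ℝ, 0 ≤ u → u ∈ decaySpace s →
      ∀ x, 1 ≤ |x| → Fop s t q u x ≤ D * weightedIntegral u * decay s x := by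
  have hC := hq.C_pos
  refine ⟨t ^ (2 - s) * 2 ^ (2 - s) * (C * (1 + t ^ 2) ^ 2), by positivity,
    fun u hu hum x hx => ?_⟩
  have hx0 : x ≠ 0 := by rintro rfl; norm_num at hx
  have hx' : 0 < |x| := by linarith
  have hW := weightedIntegral_nonneg hu
  rw [Fop_of_ne_zero _ _ _ _ hx0]
  have h1 : ∫ y, q (-y - t ^ 2 / x) * u y ≤ C * (1 + t ^ 2) ^ 2 * weightedIntegral u := by
    rw [weightedIntegral, ← integral_const_mul]
    refine integral_mono (hq.integrable_mul hs hum _)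
      ((integrable_weighted hs hum).const_mul _) fun y => ?_
    simp only
    rw [mul_div_left_comm, mul_comm]
    refine mul_le_mul_of_nonneg_left ((hq.upper _).trans ?_) (hu y)
    rw [show -y - t ^ 2 / x = -(y + t ^ 2 / x) by ring, abs_neg]
    rw [div_le_div_iff₀ (by positivity) (by positivity), mul_assoc]
    refine mul_le_mul_of_nonneg_left ?_ hC.le
    rw [← mul_pow]
    refine pow_le_pow_left₀ (by positivity) ?_ 2
    have h5 := one_add_abs_add_le (y + t ^ 2 / x) (-(t ^ 2 / x))
    rw [add_neg_cancel_right, abs_neg] at h5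
    have h6 : |t ^ 2 / x| ≤ t ^ 2 := by
      rw [abs_div, abs_of_pos (show 0 < t ^ 2 by positivity)]
      exact div_le_self (by positivity) hx
    nlinarith [abs_nonneg (y + t ^ 2 / x)]
  have h2 : t ^ (2 - s) / |x| ^ (2 - s) ≤ t ^ (2 - s) * 2 ^ (2 - s) * decay s x := by
    rw [div_eq_mul_inv, mul_assoc]
    refine mul_le_mul_of_nonneg_left ?_ (by positivity)
    rw [decay, Real.rpow_neg (by positivity), ← div_eq_mul_inv,
      inv_le_iff_one_le_mul₀ (by positivity), div_mul_eq_mul_div,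
      ← Real.mul_rpow zero_le_two hx'.le, one_le_div (by positivity)]
    exact Real.rpow_le_rpow (by positivity) (by linarith) (by linarith)
  refine (mul_le_mul_of_nonneg_left h1 (prefactor_nonneg ht x)).trans ?_
  refine (mul_le_mul_of_nonneg_right h2 (by positivity)).trans_eq ?_
  ring

theorem le_Fop_of_one_le_abs (hq : IsCauchyLike c C q) (hs : s < 1) (ht : 0 < t) :
    ∃ k, 0 < k ∧ ∀ u : ℝ → ℝ, 0 ≤ u → u ∈ decaySpace s →
      ∀ x, 1 ≤ |x| → k * weightedIntegral u * |x| ^ (-(2 - s)) ≤ Fop s t q u x := by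
  have hc := hq.c_pos
  refine ⟨t ^ (2 - s) * (c / (1 + t ^ 2) ^ 2), by positivity, fun u hu hum x hx => ?_⟩
  have hx0 : x ≠ 0 := by rintro rfl; norm_num at hx
  have hx' : 0 < |x| := by linarith
  rw [Fop_of_ne_zero _ _ _ _ hx0]
  have h1 : c / (1 + t ^ 2) ^ 2 * weightedIntegral u ≤ ∫ y, q (-y - t ^ 2 / x) * u y := by
    rw [weightedIntegral, ← integral_const_mul]
    refine integral_mono ((integrable_weighted hs hum).const_mul _)
      (hq.integrable_mul hs hum _) fun y => ?_
    simp only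
    rw [mul_div_left_comm, mul_comm _ (u y)]
    refine mul_le_mul_of_nonneg_left (le_trans ?_ (hq.lower _)) (hu y)
    rw [show -y - t ^ 2 / x = -(y + t ^ 2 / x) by ring, abs_neg, div_div]
    refine div_le_div_of_nonneg_left hc.le (by positivity) ?_
    rw [← mul_pow]
    refine pow_le_pow_left₀ (by positivity) ?_ 2
    have h5 := one_add_abs_add_le y (t ^ 2 / x)
    have h6 : |t ^ 2 / x| ≤ t ^ 2 := by
      rw [abs_div, abs_of_pos (show 0 < t ^ 2 by positivity)]
      exact div_le_self (by positivity) hx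
    nlinarith [abs_nonneg y]
  refine le_trans (le_of_eq ?_) (mul_le_mul_of_nonneg_left h1 (prefactor_nonneg ht x))
  rw [Real.rpow_neg hx'.le]
  ring

theorem exists_interval_far_from_zero (z : ℝ) : ∃ b : ℝ, ∀ y ∈ Set.Icc b (b + 1),
    1 ≤ |y| ∧ |y| ≤ 2 + |z| ∧ |y + z| ≤ 2 := by
  rcases le_total 0 z with hz | hz
  · refine ⟨-z - 2, fun y hy => ?_⟩
    rw [abs_of_nonneg hz, abs_of_nonpos (by linarith [hy.2] : y ≤ 0), abs_le]
    exact ⟨by linarith [hy.2], by linarith [hy.1], by linarith [hy.1], by linarith [hy.2]⟩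
  · refine ⟨-z + 1, fun y hy => ?_⟩
    rw [abs_of_nonpos hz, abs_of_nonneg (by linarith [hy.1] : 0 ≤ y), abs_le]
    exact ⟨by linarith [hy.1], by linarith [hy.2], by linarith [hy.1], by linarith [hy.2]⟩

theorem le_Fop_of_le (hq : IsCauchyLike c C q) (hs : s < 1) (ht : 0 < t) :
    ∃ k, 0 < k ∧ ∀ (κ : ℝ) (g : ℝ → ℝ), 0 ≤ κ → 0 ≤ g → g ∈ decaySpace s →
      (∀ y, 1 ≤ |y| → κ * |y| ^ (-(2 - s)) ≤ g y) →
      ∀ x, x ≠ 0 → k * κ * decay s x ≤ Fop s t q g x := by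
  have hc := hq.c_pos
  refine ⟨t ^ (2 - s) * (c / 9) * (2 + t ^ 2) ^ (-(2 - s)), by positivity,
    fun κ g hκ hg hgm hle x hx => ?_⟩
  have hx' : 0 < |x| := abs_pos.2 hx
  rw [Fop_of_ne_zero _ _ _ _ hx]
  obtain ⟨b, hb⟩ := exists_interval_far_from_zero (t ^ 2 / x)
  have hint := hq.integrable_mul hs hgm (t ^ 2 / x)
  have h1 : c / 9 * (κ * (2 + |t ^ 2 / x|) ^ (-(2 - s))) ≤ ∫ y, q (-y - t ^ 2 / x) * g y := by
    refine le_trans ?_ (setIntegral_le_integral (s := Set.Icc b (b + 1)) hint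
      (ae_of_all _ fun y => mul_nonneg (hq.nonneg _) (hg y)))
    have h2 := setIntegral_ge_of_const_le (μ := volume) (s := Set.Icc b (b + 1))
      (c := c / 9 * (κ * (2 + |t ^ 2 / x|) ^ (-(2 - s))))
      (f := fun y => q (-y - t ^ 2 / x) * g y) measurableSet_Icc (by simp) (fun y hy => ?_)
      hint.integrableOn
    · simpa using h2
    · obtain ⟨hy1, hy2, hy3⟩ := hb y hy
      refine mul_le_mul (le_trans ?_ (hq.lower _)) (le_trans ?_ (hle y hy1)) (by positivity)
        (hq.nonneg _)
      · rw [show -y - t ^ 2 / x = -(y + t ^ 2 / x) by ring, abs_neg]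
        refine div_le_div_of_nonneg_left hc.le (by positivity) ?_
        nlinarith [abs_nonneg (y + t ^ 2 / x)]
      · refine mul_le_mul_of_nonneg_left ?_ hκ
        exact Real.rpow_le_rpow_of_nonpos (by linarith) hy2 (by linarith)
  refine le_trans ?_ (mul_le_mul_of_nonneg_left h1 (prefactor_nonneg ht x))
  have h3 : (2 + t ^ 2) ^ (-(2 - s)) * decay s x ≤
      |x| ^ (-(2 - s)) * (2 + |t ^ 2 / x|) ^ (-(2 - s)) := by
    rw [decay, ← Real.mul_rpow (by positivity) (by positivity),
      ← Real.mul_rpow (by positivity) (by positivity)]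
    refine Real.rpow_le_rpow_of_nonpos (by positivity) ?_ (by linarith)
    rw [abs_div, abs_of_pos (show 0 < t ^ 2 by positivity), mul_add, mul_div_cancel₀ _ hx'.ne']
    nlinarith [sq_nonneg t]
  have h4 := mul_le_mul_of_nonneg_left h3 (show 0 ≤ t ^ (2 - s) * (c / 9) * κ by positivity)
  rw [div_eq_mul_inv (t ^ (2 - s)), ← Real.rpow_neg hx'.le]
  linarith

theorem le_weightedIntegral_Fop (hq : IsCauchyLike c C q) (hs0 : 0 < s) (hs : s < 1)
    (ht : 0 < t) :
    ∃ k, 0 < k ∧ ∀ u : ℝ → ℝ, 0 ≤ u → u ∈ decaySpace s →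
      k * weightedIntegral u ≤ weightedIntegral (Fop s t q u) := by
  obtain ⟨k, hk, h⟩ := le_Fop_of_one_le_abs hq hs ht
  refine ⟨k * 2 ^ (-(2 - s)) / 9, by positivity, fun u hu hum => ?_⟩
  have hFu := Fop_nonneg (s := s) hq ht hu
  have hint := integrable_weighted hs (Fop_mem hq hs0 hs ht hum)
  have hW := weightedIntegral_nonneg hu
  refine le_trans ?_ (setIntegral_le_integral (s := Set.Icc 1 2) hint
    (ae_of_all _ fun y => div_nonneg (hFu y) (by positivity)))
  have h2 := setIntegral_ge_of_const_le (μ := volume) (s := Set.Icc (1 : ℝ) 2)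
    (c := k * 2 ^ (-(2 - s)) / 9 * weightedIntegral u)
    (f := fun y => Fop s t q u y / (1 + |y|) ^ 2) measurableSet_Icc (by simp) (fun y hy => ?_)
    hint.integrableOn
  · have hv : (volume : Measure ℝ).real (Set.Icc 1 2) = 1 := by
      rw [measureReal_def, Real.volume_Icc]; norm_num
    rwa [hv, one_smul] at h2
  · have hy1 : 1 ≤ |y| := hy.1.trans (le_abs_self y)
    have hy2 : |y| ≤ 2 := by rw [abs_of_nonneg (by linarith [hy.1])]; exact hy.2
    rw [le_div_iff₀ (by positivity)]
    refine le_trans ?_ (h u hu hum y hy1)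
    have h3 : (2 : ℝ) ^ (-(2 - s)) ≤ |y| ^ (-(2 - s)) :=
      Real.rpow_le_rpow_of_nonpos (by linarith) hy2 (by linarith)
    have h4 : (1 + |y|) ^ 2 ≤ 9 := by nlinarith
    have h5 := mul_le_mul h4 h3 (by positivity) (by norm_num)
    have h6 := mul_le_mul_of_nonneg_left h5 (mul_nonneg hk.le hW)
    linarith

theorem weightedIntegral_pos (hs : s < 1) {u : ℝ → ℝ} (hu : 0 ≤ u) (hum : u ∈ decaySpace s)
    (hne : ¬ ∀ᵐ x : ℝ, u x = 0) : 0 < weightedIntegral u := by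
  refine (weightedIntegral_nonneg hu).lt_of_ne fun h => hne ?_
  have h0 := (integral_eq_zero_iff_of_nonneg (fun y => div_nonneg (hu y) (by positivity))
    (integrable_weighted hs hum)).1 h.symm
  filter_upwards [h0] with x hx
  have : (1 + |x|) ^ 2 ≠ 0 := by positivity
  simpa [this] using hx

theorem exists_rank_one_bounds (hq : IsCauchyLike c C q) (hs0 : 0 < s) (hs : s < 1)
    (ht : 0 < t) :
    ∃ m M, 0 < m ∧ m ≤ M ∧ ∀ u : ℝ → ℝ, 0 ≤ u → u ∈ decaySpace s → ∀ x, x ≠ 0 →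
      m * weightedIntegral (Fop s t q u) * decay s x ≤
        Fop s t q (Fop s t q (Fop s t q u)) x ∧
      Fop s t q (Fop s t q (Fop s t q u)) x ≤
        M * weightedIntegral (Fop s t q u) * decay s x := by
  obtain ⟨k₁, hk₁, h₁⟩ := le_Fop_of_one_le_abs hq hs ht
  obtain ⟨k₂, hk₂, h₂⟩ := le_Fop_of_le hq hs ht
  obtain ⟨k₃, hk₃, h₃⟩ := le_weightedIntegral_Fop hq hs0 hs ht
  obtain ⟨D₁, hD₁, h₄⟩ := abs_Fop_le hq hs0 hs ht
  obtain ⟨D₂, hD₂, h₅⟩ := Fop_le_of_one_le_abs hq hs ht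
  obtain ⟨D₃, hD₃, h₆⟩ := Fop_le_weightedIntegral_add hq hs0 hs ht
  refine ⟨k₂ * k₁, max (k₂ * k₁) (D₁ * (D₃ * (1 + D₂ / k₃))), by positivity, le_max_left _ _,
    fun u hu hum x hx => ?_⟩
  have hu1 := Fop_nonneg (s := s) hq ht hu
  have hu2 := Fop_nonneg (s := s) hq ht hu1
  have hm1 := Fop_mem hq hs0 hs ht hum
  have hm2 := Fop_mem hq hs0 hs ht hm1
  have hW := weightedIntegral_nonneg hu
  have hW1 := weightedIntegral_nonneg hu1
  have hd := decay_pos s x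
  constructor
  · have := h₂ (k₁ * weightedIntegral (Fop s t q u)) _ (by positivity) hu2 hm2
      (h₁ _ hu1 hm1) x hx
    linarith
  · have hB : 0 ≤ D₃ * (1 + D₂ / k₃) * weightedIntegral (Fop s t q u) := by positivity
    have hsq : ∀ y, |Fop s t q (Fop s t q u) y| ≤
        D₃ * (1 + D₂ / k₃) * weightedIntegral (Fop s t q u) * decay s y := by
      intro y
      have hdy := decay_pos s y
      rw [abs_of_nonneg (hu2 y)]
      by_cases hy : y = 0
      · rw [hy, Fop_zero]; exact mul_nonneg hB (decay_pos s 0).le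
      · refine (h₆ (D₂ * weightedIntegral u) _ (by positivity) hu1 hm1 (h₅ u hu hum) y hy).trans ?_
        refine mul_le_mul_of_nonneg_right ?_ hdy.le
        rw [mul_assoc]
        refine mul_le_mul_of_nonneg_left ?_ hD₃.le
        have : D₂ * weightedIntegral u ≤ D₂ / k₃ * weightedIntegral (Fop s t q u) := by
          rw [div_mul_eq_mul_div, le_div_iff₀ hk₃]
          have := mul_le_mul_of_nonneg_left (h₃ u hu hum) hD₂.le
          linarith
        linarith
    refine (le_abs_self _).trans ((h₄ _ _ hB hm2 hsq x).trans ?_)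
    rw [← mul_assoc D₁]
    exact mul_le_mul_of_nonneg_right
      (mul_le_mul_of_nonneg_right (le_max_right _ _) hW1) hd.le

/-- The transfer operator as a linear map on `decaySpace s`. -/
noncomputable def transferMap (hq : IsCauchyLike c C q) (hs0 : 0 < s) (hs : s < 1) (ht : 0 < t) :
    decaySpace s →ₗ[ℝ] decaySpace s where
  toFun u := ⟨Fop s t q u, Fop_mem hq hs0 hs ht u.2⟩
  map_add' u v := by
    ext x
    by_cases hx : x = 0
    · simp [hx, Fop_zero]
    · simp only [Submodule.coe_add, Pi.add_apply, Fop_of_ne_zero _ _ _ _ hx, mul_add]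
      rw [integral_add (hq.integrable_mul hs u.2 _) (hq.integrable_mul hs v.2 _), mul_add]
  map_smul' r u := by
    ext x
    by_cases hx : x = 0
    · simp [hx, Fop_zero]
    · simp only [Submodule.coe_smul, Pi.smul_apply, smul_eq_mul, RingHom.id_apply,
        Fop_of_ne_zero _ _ _ _ hx, mul_left_comm _ r, integral_const_mul]

/-- `weightedIntegral` as a linear functional on `decaySpace s`. -/
noncomputable def weightedIntegralMap (hs : s < 1) : decaySpace s →ₗ[ℝ] ℝ where
  toFun u := weightedIntegral u
  map_add' u v := by
    simp only [weightedIntegral, Submodule.coe_add, Pi.add_apply, add_div]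
    exact integral_add (integrable_weighted hs u.2) (integrable_weighted hs v.2)
  map_smul' r u := by
    simp only [weightedIntegral, Submodule.coe_smul, Pi.smul_apply, smul_eq_mul,
      RingHom.id_apply, mul_div_assoc, integral_const_mul]

/-- `decay s`, set to zero at the origin. -/
noncomputable def puncturedDecay (s : ℝ) : decaySpace s :=
  ⟨fun x => if x = 0 then 0 else decay s x,
    Measurable.ite (measurableSet_singleton 0) measurable_const (measurable_decay s), 1,
    fun x => by
      have := decay_pos s x
      dsimp only
      split_ifs
      · simpa using this.le
      · rw [one_mul, abs_of_pos this]⟩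

theorem puncturedDecay_apply (s : ℝ) {x : ℝ} (hx : x ≠ 0) :
    (puncturedDecay s : ℝ → ℝ) x = decay s x := if_neg hx

theorem puncturedDecay_zero (s : ℝ) : (puncturedDecay s : ℝ → ℝ) 0 = 0 := if_pos rfl

theorem puncturedDecay_nonneg (s : ℝ) : 0 ≤ puncturedDecay s := by
  intro x
  by_cases hx : x = 0
  · rw [hx, puncturedDecay_zero]; rfl
  · rw [puncturedDecay_apply s hx]; exact (decay_pos s x).le

theorem tendsto_Fop (hq : IsCauchyLike c C q) (hs : s < 1) {h : ℕ → ℝ → ℝ} {v : ℝ → ℝ} {B : ℝ}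
    (hm : ∀ n, h n ∈ decaySpace s) (hB : ∀ n x, |h n x| ≤ B * decay s x)
    (hlim : ∀ x, Filter.Tendsto (fun n => h n x) Filter.atTop (nhds (v x))) (x : ℝ) :
    Filter.Tendsto (fun n => Fop s t q (h n) x) Filter.atTop (nhds (Fop s t q v x)) := by
  by_cases hx : x = 0
  · simp [hx, Fop_zero]
  simp only [Fop_of_ne_zero _ _ _ _ hx]
  refine Filter.Tendsto.const_mul _ (tendsto_integral_of_dominated_convergence
    (fun y => C * (B * decay s y)) (fun n => (hq.integrable_mul hs (hm n) _).aestronglyMeasurable)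
    (((integrable_decay hs).const_mul B).const_mul C) (fun n => ae_of_all _ fun y => ?_)
    (ae_of_all _ fun y => (hlim y).const_mul _))
  rw [norm_mul, norm_of_nonneg (hq.nonneg _)]
  exact mul_le_mul (hq.le_const _) (hB n y) (norm_nonneg _) hq.C_pos.le

theorem Fop_congr_ae {u v : ℝ → ℝ} (h : u =ᵐ[volume] v) : Fop s t q u = Fop s t q v := by
  ext x
  simp only [Fop]
  congr 2
  exact integral_congr_ae (h.mono fun y hy => by simp only [hy])

theorem decay_mul_wfun_le (hs : s < 1) (x : ℝ) : decay s x * wfun s x ≤ 2 := by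
  have h1 : (1 : ℝ) ≤ (1 + |x|) ^ (2 - s) :=
    Real.one_le_rpow (by linarith [abs_nonneg x]) (by linarith)
  have h2 : |x| ^ (2 - s) ≤ (1 + |x|) ^ (2 - s) :=
    Real.rpow_le_rpow (abs_nonneg x) (by linarith) (by linarith)
  rw [decay, wfun, Real.rpow_neg (by positivity), inv_mul_le_iff₀ (by linarith)]
  linarith

theorem one_le_decay_mul_wfun (hs : s < 1) (x : ℝ) :
    1 ≤ 2 ^ (2 - s) * decay s x * wfun s x := by
  have h1 : (1 + |x|) ^ (2 - s) ≤ 2 ^ (2 - s) * wfun s x := by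
    have h2 : 1 + |x| ≤ 2 * max 1 |x| := by
      linarith [le_max_left 1 |x|, le_max_right 1 |x|]
    have h3 := Real.rpow_le_rpow (by positivity) h2 (show 0 ≤ 2 - s by linarith)
    rw [Real.mul_rpow zero_le_two (by positivity)] at h3
    refine h3.trans (mul_le_mul_of_nonneg_left ?_ (by positivity))
    rw [wfun]
    rcases max_choice 1 |x| with h | h <;> rw [h]
    · rw [Real.one_rpow]; linarith [Real.rpow_nonneg (abs_nonneg x) (2 - s)]
    · linarith
  rw [mul_right_comm, decay, Real.rpow_neg (by positivity), ← div_eq_mul_inv,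
    one_le_div (by positivity)]
  exact h1

theorem mem_decaySpace_of_bddAbove (hs : s < 1) {u : ℝ → ℝ} (hu : Measurable u)
    (hb : BddAbove (Set.range fun x => |u x| * wfun s x)) : u ∈ decaySpace s := by
  obtain ⟨B, hB⟩ := hb
  refine ⟨hu, B * 2 ^ (2 - s), fun x => ?_⟩
  have h1 : |u x| * wfun s x ≤ B := hB ⟨x, rfl⟩
  have hd := decay_pos s x
  have h2 := mul_le_mul_of_nonneg_left (one_le_decay_mul_wfun hs x) (abs_nonneg (u x))
  have h3 := mul_le_mul_of_nonneg_right h1 (show 0 ≤ 2 ^ (2 - s) * decay s x by positivity)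
  linarith

theorem bddAbove_of_abs_le (hs : s < 1) {u : ℝ → ℝ} {B : ℝ} (hB : 0 ≤ B)
    (hu : ∀ x, |u x| ≤ B * decay s x) : BddAbove (Set.range fun x => |u x| * wfun s x) := by
  refine ⟨B * 2, ?_⟩
  rintro _ ⟨x, rfl⟩
  have hw : 0 ≤ wfun s x := by unfold wfun; positivity
  have h1 := mul_le_mul_of_nonneg_right (hu x) hw
  have h2 := mul_le_mul_of_nonneg_left (decay_mul_wfun_le hs x) hB
  simp only
  linarith

theorem transferMap_nonneg (hq : IsCauchyLike c C q) (hs0 : 0 < s) (hs : s < 1) (ht : 0 < t)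
    (u : decaySpace s) (hu : 0 ≤ u) : 0 ≤ transferMap hq hs0 hs ht u :=
  Fop_nonneg hq ht hu

theorem weightedIntegralMap_nonneg (hs : s < 1) (u : decaySpace s) (hu : 0 ≤ u) :
    0 ≤ weightedIntegralMap hs u :=
  weightedIntegral_nonneg hu

theorem weightedIntegralMap_transferMap_pos (hq : IsCauchyLike c C q) (hs0 : 0 < s) (hs : s < 1)
    (ht : 0 < t) (u : decaySpace s) (hu : 0 ≤ u) (hpos : 0 < weightedIntegralMap hs u) :
    0 < weightedIntegralMap hs (transferMap hq hs0 hs ht u) := by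
  obtain ⟨k, hk, h⟩ := le_weightedIntegral_Fop hq hs0 hs ht
  exact lt_of_lt_of_le (mul_pos hk hpos) (h u hu u.2)

theorem weightedIntegralMap_puncturedDecay_pos (hs : s < 1) :
    0 < weightedIntegralMap hs (puncturedDecay s) := by
  refine weightedIntegral_pos hs (puncturedDecay_nonneg s) (puncturedDecay s).2 fun h => ?_
  have h0 : ∀ᵐ x : ℝ, x ≠ 0 := by simp [ae_iff]
  have : ∀ᵐ _ : ℝ, False := by
    filter_upwards [h, h0] with x hx hx0
    rw [puncturedDecay_apply s hx0] at hx
    exact (decay_pos s x).ne' hx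
  obtain ⟨_, h⟩ := this.exists
  exact h

theorem exists_transferMap_cube_bounds (hq : IsCauchyLike c C q) (hs0 : 0 < s) (hs : s < 1)
    (ht : 0 < t) :
    ∃ m M, 0 < m ∧ m ≤ M ∧ ∀ u : decaySpace s, 0 ≤ u →
      (m * (weightedIntegralMap hs ∘ₗ transferMap hq hs0 hs ht) u) • puncturedDecay s ≤
        transferMap hq hs0 hs ht (transferMap hq hs0 hs ht (transferMap hq hs0 hs ht u)) ∧
      transferMap hq hs0 hs ht (transferMap hq hs0 hs ht (transferMap hq hs0 hs ht u)) ≤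
        (M * (weightedIntegralMap hs ∘ₗ transferMap hq hs0 hs ht) u) • puncturedDecay s := by
  obtain ⟨m, M, hm, hmM, h⟩ := exists_rank_one_bounds hq hs0 hs ht
  refine ⟨m, M, hm, hmM, fun u hu => ⟨fun x => ?_, fun x => ?_⟩⟩
  · change _ * (puncturedDecay s : ℝ → ℝ) x ≤ Fop s t q _ x
    by_cases hx : x = 0
    · rw [hx, puncturedDecay_zero, Fop_zero, mul_zero]
    · rw [puncturedDecay_apply s hx]; exact (h u hu u.2 x hx).1
  · change Fop s t q _ x ≤ _ * (puncturedDecay s : ℝ → ℝ) x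
    by_cases hx : x = 0
    · rw [hx, puncturedDecay_zero, Fop_zero, mul_zero]
    · rw [puncturedDecay_apply s hx]; exact (h u hu u.2 x hx).2

theorem exists_transferMap_eigenvector (hq : IsCauchyLike c C q) (hs0 : 0 < s) (hs : s < 1)
    (ht : 0 < t) :
    ∃ lam b : ℝ, 0 < lam ∧ 0 < b ∧ ∃ v : decaySpace s,
      b • puncturedDecay s ≤ v ∧ transferMap hq hs0 hs ht v = lam • v := by
  obtain ⟨m, M, hm, hmM, hbd⟩ := exists_transferMap_cube_bounds hq hs0 hs ht
  have hφ := puncturedDecay_nonneg s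
  have hT := transferMap_nonneg hq hs0 hs ht
  have p1 := weightedIntegralMap_puncturedDecay_pos hs
  have p2 := weightedIntegralMap_transferMap_pos hq hs0 hs ht _ hφ p1
  have p3 := weightedIntegralMap_transferMap_pos hq hs0 hs ht _ (hT _ hφ) p2
  obtain ⟨lam, b, h, α, β, hlam, hb, hα, hβ, happrox, hanti, hbelow⟩ :=
    exists_approx_eigenvectors (transferMap hq hs0 hs ht) hT
      (weightedIntegralMap hs ∘ₗ transferMap hq hs0 hs ht)
      (fun u hu => weightedIntegralMap_nonneg hs _ (hT u hu)) hm hmM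
      (fun u hu => (hbd u hu).1) (fun u hu => (hbd u hu).2) hφ p2 p3
  have hlow : ∀ n x, b * (puncturedDecay s : ℝ → ℝ) x ≤ (h n : ℝ → ℝ) x := fun n x => hbelow n x
  have hnn : ∀ n x, 0 ≤ (h n : ℝ → ℝ) x := fun n x =>
    (mul_nonneg hb.le (hφ x)).trans (hlow n x)
  set v : ℝ → ℝ := fun x => ⨅ n, (h n : ℝ → ℝ) x with hv
  have hlim : ∀ x, Filter.Tendsto (fun n => (h n : ℝ → ℝ) x) Filter.atTop (nhds (v x)) :=
    fun x => tendsto_atTop_ciInf (fun i j hij => hanti hij x)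
      ⟨0, by rintro _ ⟨n, rfl⟩; exact hnn n x⟩
  obtain ⟨B, hB⟩ := (h 0).2.2
  have hbdd : ∀ n x, |(h n : ℝ → ℝ) x| ≤ B * decay s x := fun n x => by
    rw [abs_of_nonneg (hnn n x)]
    exact (hanti (Nat.zero_le n) x).trans ((le_abs_self _).trans (hB x))
  have hvm : v ∈ decaySpace s :=
    ⟨measurable_of_tendsto_metrizable (fun n => (h n).2.1) (tendsto_pi_nhds.2 hlim), B,
      fun x => le_of_tendsto' (hlim x).abs fun n => hbdd n x⟩
  refine ⟨lam, b, hlam, hb, ⟨v, hvm⟩, fun x => ge_of_tendsto' (hlim x) fun n => hlow n x, ?_⟩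
  ext x
  refine tendsto_nhds_unique (tendsto_Fop hq hs (fun n => (h n).2) hbdd hlim x) ?_
  exact tendsto_of_tendsto_of_tendsto_of_le_of_le (hα.mul (hlim x)) (hβ.mul (hlim x))
    (fun n => (happrox n).1 x) (fun n => (happrox n).2 x)

theorem transferMap_eigenvector_bounds (hq : IsCauchyLike c C q) (hs0 : 0 < s) (hs : s < 1)
    (ht : 0 < t) {u : decaySpace s} {mu : ℝ} (hu : 0 ≤ u) (hpos : 0 < weightedIntegralMap hs u)
    (hev : transferMap hq hs0 hs ht u = mu • u) :
    0 < mu ∧ ∃ a b : ℝ, 0 < a ∧ 0 < b ∧ a • puncturedDecay s ≤ u ∧ u ≤ b • puncturedDecay s := by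
  obtain ⟨m, M, hm, hmM, hbd⟩ := exists_transferMap_cube_bounds hq hs0 hs ht
  have hTpos := weightedIntegralMap_transferMap_pos hq hs0 hs ht u hu hpos
  have hmu : 0 < mu := by
    rw [hev, map_smul, smul_eq_mul] at hTpos
    exact pos_of_mul_pos_left hTpos hpos.le
  have hM := hm.trans_le hmM
  obtain ⟨h1, h2⟩ := hbd u hu
  rw [LinearMap.comp_apply] at h1 h2
  set S := weightedIntegralMap hs (transferMap hq hs0 hs ht u)
  simp only [hev, map_smul, smul_smul] at h1 h2
  have hinv : 0 ≤ (mu * mu * mu)⁻¹ := by positivity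
  have hne : mu * mu * mu ≠ 0 := by positivity
  have h3 := smul_le_smul_of_nonneg_left h1 hinv
  have h4 := smul_le_smul_of_nonneg_left h2 hinv
  rw [smul_smul, smul_smul, inv_mul_cancel₀ hne, one_smul] at h3 h4
  exact ⟨hmu, _, _, mul_pos (by positivity) (mul_pos hm hTpos),
    mul_pos (by positivity) (mul_pos hM hTpos), h3, h4⟩

theorem transferMap_eigenvalue_le (hq : IsCauchyLike c C q) (hs0 : 0 < s) (hs : s < 1)
    (ht : 0 < t) {u v : decaySpace s} {mu lam : ℝ} (hu : 0 ≤ u) (hv : 0 ≤ v)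
    (hupos : 0 < weightedIntegralMap hs u) (hvpos : 0 < weightedIntegralMap hs v)
    (huev : transferMap hq hs0 hs ht u = mu • u) (hvev : transferMap hq hs0 hs ht v = lam • v) :
    mu ≤ lam := by
  obtain ⟨-, -, b, -, hb, -, hub⟩ := transferMap_eigenvector_bounds hq hs0 hs ht hu hupos huev
  obtain ⟨hlam, a, -, ha, -, hva, -⟩ := transferMap_eigenvector_bounds hq hs0 hs ht hv hvpos hvev
  refine eigenvalue_le_of_le_smul (transferMap hq hs0 hs ht) (transferMap_nonneg hq hs0 hs ht)
    (weightedIntegralMap hs) (weightedIntegralMap_nonneg hs) hlam huev hvev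
    (C := b * a⁻¹) ?_ hupos
  have h1 := smul_le_smul_of_nonneg_left hva (show 0 ≤ b * a⁻¹ by positivity)
  rw [smul_smul, inv_mul_cancel_right₀ ha.ne'] at h1
  exact hub.trans h1

end Kernel

/-- **Krein–Rutman for the transfer operator.** Let `s ∈ (0,1)`, `t > 0`,
`E ∈ ℝ`, `L, C₀, c₀ > 0`, and let `q` be a probability density, Lipschitz with constant
`L`, with `c₀/(1 + (x + E)²) ≤ q(x) ≤ C₀/(1 + (x + E)²)`.  Then there exist `λ > 0` and
`v : ℝ → ℝ` with `v > 0` everywhere and `‖v‖ < ∞` such that `(Fv)(x) = λ·v(x)` for every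
`x ≠ 0`; moreover `λ` is the unique eigenvalue of `F` possessing a nonnegative
eigenfunction that is not Lebesgue-a.e. zero. -/
theorem stmt13 (s t E L C₀ c₀ : ℝ) (hs : s ∈ Set.Ioo (0 : ℝ) 1) (ht : 0 < t)
    (hL : 0 < L) (hC₀ : 0 < C₀) (hc₀ : 0 < c₀)
    (q : ℝ → ℝ) (hq : IsProbDensity q) (hlip : ∀ x y : ℝ, |q x - q y| ≤ L * |x - y|)
    (hlow : ∀ x, c₀ / (1 + (x + E) ^ 2) ≤ q x)
    (hupp : ∀ x, q x ≤ C₀ / (1 + (x + E) ^ 2)) :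
    ∃ lam : ℝ, 0 < lam ∧ ∃ v : ℝ → ℝ,
      (∀ x, 0 < v x) ∧
      BddAbove (Set.range fun x => |v x| * wfun s x) ∧
      (∀ x : ℝ, x ≠ 0 → Fop s t q v x = lam * v x) ∧
      ∀ (mu : ℝ) (u : ℝ → ℝ), Measurable u → (∀ x, 0 ≤ u x) →
        BddAbove (Set.range fun x => |u x| * wfun s x) →
        ¬ (∀ᵐ x : ℝ, u x = 0) →
        (∀ x : ℝ, x ≠ 0 → Fop s t q u x = mu * u x) →
        mu = lam := by
  obtain ⟨hs0, hs1⟩ := hs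
  have hK := isCauchyLike_of_shifted hq.1 hC₀ hc₀ hlow hupp
  obtain ⟨lam, b, hlam, hb, v, hbv, hv⟩ := exists_transferMap_eigenvector hK hs0 hs1 ht
  have hev : ∀ x, Fop s t q v x = lam * (v : ℝ → ℝ) x := fun x =>
    congrFun (congrArg Subtype.val hv) x
  have hvpos : ∀ x, x ≠ 0 → 0 < (v : ℝ → ℝ) x := fun x hx =>
    lt_of_lt_of_le (by rw [puncturedDecay_apply s hx]; exact mul_pos hb (decay_pos s x))
      (show b * (puncturedDecay s : ℝ → ℝ) x ≤ (v : ℝ → ℝ) x from hbv x)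
  have hv0 : 0 ≤ v := le_trans (smul_nonneg hb.le (puncturedDecay_nonneg s)) hbv
  have hupd : ∀ u : ℝ → ℝ, ∀ r : ℝ, Function.update u 0 r =ᵐ[volume] u := fun u r => by
    have h0 : ∀ᵐ x : ℝ, x ≠ 0 := by simp [ae_iff]
    filter_upwards [h0] with x hx using Function.update_of_ne hx _ _
  refine ⟨lam, hlam, Function.update v 0 1, fun x => ?_, ?_, fun x hx => ?_,
    fun mu u hum hu hbdd hne huev => ?_⟩
  · by_cases hx : x = 0
    · rw [hx, Function.update_self]; exact one_pos
    · rw [Function.update_of_ne hx]; exact hvpos x hx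
  · obtain ⟨B, hB⟩ := v.2.2
    have hd0 : decay s 0 = 1 := by simp [decay]
    refine bddAbove_of_abs_le hs1 (le_max_right B 1 |>.trans' zero_le_one) fun x => ?_
    by_cases hx : x = 0
    · rw [hx, Function.update_self, hd0, abs_one, mul_one]; exact le_max_right _ _
    · rw [Function.update_of_ne hx]
      exact (hB x).trans (mul_le_mul_of_nonneg_right (le_max_left _ _) (decay_pos s x).le)
  · rw [Fop_congr_ae (hupd v 1), Function.update_of_ne hx]
    exact hev x
  · have hmem := mem_decaySpace_of_bddAbove hs1 hum hbdd
    have hu0 : ∀ x, 0 ≤ Function.update u 0 0 x := fun x => by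
      by_cases hx : x = 0
      · rw [hx, Function.update_self]
      · rw [Function.update_of_ne hx]; exact hu x
    have hmem' : Function.update u 0 0 ∈ decaySpace s := by
      obtain ⟨B, hB⟩ := hmem.2
      have hite : Function.update u 0 0 = fun x => if x = 0 then 0 else u x := by
        ext x
        simp [Function.update_apply]
      refine ⟨hite ▸ Measurable.ite (measurableSet_singleton 0) measurable_const hum, B,
        fun x => ?_⟩
      by_cases hx : x = 0
      · rw [hx, Function.update_self, abs_zero]
        exact (abs_nonneg _).trans (hB 0)
      · rw [Function.update_of_ne hx]; exact hB x
    set u' : decaySpace s := ⟨Function.update u 0 0, hmem'⟩ with hu'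
    have hu'ev : transferMap hK hs0 hs1 ht u' = mu • u' := by
      ext x
      change Fop s t q (Function.update u 0 0) x = mu * Function.update u 0 0 x
      rw [Fop_congr_ae (hupd u 0)]
      by_cases hx : x = 0
      · rw [hx, Fop_zero, Function.update_self, mul_zero]
      · rw [Function.update_of_ne hx]; exact huev x hx
    have hu'pos : 0 < weightedIntegralMap hs1 u' := by
      refine weightedIntegral_pos hs1 hu0 hmem' fun h => hne ?_
      filter_upwards [h, hupd u 0] with x hx hx' using hx' ▸ hx
    have hv'pos : 0 < weightedIntegralMap hs1 v := by
      have h1 := weightedIntegralMap_nonneg hs1 _ (sub_nonneg.2 hbv)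
      rw [map_sub, map_smul, smul_eq_mul, sub_nonneg] at h1
      exact lt_of_lt_of_le (mul_pos hb (weightedIntegralMap_puncturedDecay_pos hs1)) h1
    exact le_antisymm
      (transferMap_eigenvalue_le hK hs0 hs1 ht hu0 hv0 hu'pos hv'pos hu'ev hv)
      (transferMap_eigenvalue_le hK hs0 hs1 ht hv0 hu0 hv'pos hu'pos hv hu'ev)
end
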